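/- arXiv:1908.05225 — 2 statements merged into one kernel-verified Lean document; each statement's English description precedes it below -/
import Mathlib

section
/- Let G = (V, E) be a finite τ-critical simple graph with transversal number τ(G) = t. Then |V| + |E| ≤ (t+2 choose 2). -/
open SimpleGraph

/-- A transversal set (vertex cover): a set of vertices meeting every edge. -/
def IsTransversal {V : Type*} (G : SimpleGraph V) (S : Set V) : Prop :=
  ∀ ⦃u v : V⦄, G.Adj u v → u ∈ S ∨ v ∈ S

/-- The transversal number: minimum cardinality of a transversal set. -/
noncomputable def tau {V : Type*} [Fintype V] (G : SimpleGraph V) : ℕ :=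
  sInf {n | ∃ S : Finset V, IsTransversal G ↑S ∧ S.card = n}

/-- A graph with no isolated vertices is τ-critical if deleting any edge
decreases the transversal number by one. -/
def TauCritical {V : Type*} [Fintype V] (G : SimpleGraph V) : Prop :=
  (∀ v : V, ∃ u, G.Adj v u) ∧
  ∀ e ∈ G.edgeSet, tau (G.deleteEdges {e}) = tau G - 1


section IndepSet

variable {V : Type*} {G : SimpleGraph V}

lemma isIndepSet_coe_iff {S : Finset V} :
    G.IsIndepSet (S : Set V) ↔ ∀ u ∈ S, ∀ v ∈ S, ¬ G.Adj u v :=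
  ⟨fun h _ hu _ hv huv => h hu hv huv.ne huv, fun h u hu v hv _ => h u hu v hv⟩

variable [Fintype V] [DecidableEq V]

/-- Hajnal's lemma: the union and the intersection of a nonempty family of maximum independent
sets have together at least `2 α` elements. -/
lemma two_mul_indepNum_le_card_union_add_card_inter (F : Finset (Finset V)) (hF : F.Nonempty)
    (hmax : ∀ S ∈ F, G.IsNIndepSet G.indepNum S) :
    2 * G.indepNum ≤ (F.biUnion id).card + ({v | ∀ S ∈ F, v ∈ S} : Finset V).card := by
  induction hF using Finset.Nonempty.cons_induction with
  | singleton S =>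
    have hS := (hmax S (by simp)).card_eq
    simp [hS, two_mul]
  | cons S F hSF hF ih =>
    specialize ih fun T hT => hmax T (Finset.mem_cons_of_mem hT)
    have hS := hmax S (Finset.mem_cons_self S F)
    set U := F.biUnion id with hU
    set I : Finset V := {v | ∀ T ∈ F, v ∈ T} with hI
    have hU' : (Finset.cons S F hSF).biUnion id = U ∪ (S \ U) := by
      ext v; simp [hU]; grind
    have hI' : ({v | ∀ T ∈ Finset.cons S F hSF, v ∈ T} : Finset V) = I \ (I \ S) := by
      ext v; simp [hI]; grind
    have hind : G.IsIndepSet ((S ∩ U ∪ I \ S : Finset V) : Set V) := by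
      have hadj := isIndepSet_coe_iff.1 hS.isIndepSet
      have hF' : ∀ T ∈ F, ∀ u ∈ T, ∀ v ∈ T, ¬ G.Adj u v := fun T hT =>
        isIndepSet_coe_iff.1 (hmax T (Finset.mem_cons_of_mem hT)).isIndepSet
      have hUI : ∀ u ∈ U, ∀ v ∈ I, ¬ G.Adj u v := by
        intro u hu v hv
        obtain ⟨T, hT, huT⟩ := Finset.mem_biUnion.1 hu
        exact hF' T hT u huT v ((Finset.mem_filter.1 hv).2 T hT)
      have hIU : I ⊆ U := fun v hv => by
        obtain ⟨T, hT⟩ := hF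
        exact Finset.mem_biUnion.2 ⟨T, hT, (Finset.mem_filter.1 hv).2 T hT⟩
      rw [isIndepSet_coe_iff]
      intro u hu v hv
      have := G.adj_comm u v
      grind
    have hcard := hind.card_le_indepNum
    rw [Finset.card_union_of_disjoint (by
      rw [Finset.disjoint_left]; grind), ← hS.card_eq,
      ← Finset.card_inter_add_card_sdiff S U] at hcard
    rw [hU', hI', Finset.card_union_of_disjoint Finset.disjoint_sdiff,
      Finset.card_sdiff_of_subset Finset.sdiff_subset]
    have := Finset.card_le_card (Finset.sdiff_subset : I \ S ⊆ I)
    lia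

variable [DecidableRel G.Adj]

/-- If no vertex lies in all maximum independent sets, then every independent set `X` has at least
`|X|` neighbours. -/
lemma card_le_card_biUnion_neighborFinset
    (havoid : ∀ v, ∃ S, G.IsNIndepSet G.indepNum S ∧ v ∉ S) (X : Finset V)
    (hX : G.IsIndepSet (X : Set V)) : X.card ≤ (X.biUnion fun w => G.neighborFinset w).card := by
  induction X using Finset.strongInduction with
  | H X ih =>
    obtain rfl | ⟨x, hx⟩ := X.eq_empty_or_nonempty
    · simp
    obtain ⟨S, hS, hxS⟩ := havoid x
    have hsub : X ∩ S ⊂ X :=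
      Finset.ssubset_iff_subset_ne.2 ⟨Finset.inter_subset_left, fun h => by grind⟩
    have hXS := ih _ hsub (hX.mono (by simp))
    set N := X.biUnion fun w => G.neighborFinset w with hN
    have hXadj := isIndepSet_coe_iff.1 hX
    have hSadj := isIndepSet_coe_iff.1 hS.isIndepSet
    have hmemN : ∀ v, v ∈ N ↔ ∃ u ∈ X, G.Adj u v := by simp [hN]
    have hswap : G.IsIndepSet ((S \ N ∪ X \ S : Finset V) : Set V) := by
      rw [isIndepSet_coe_iff]
      intro u hu v hv
      have := G.adj_comm u v
      grind
    have hcard := hswap.card_le_indepNum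
    rw [Finset.card_union_of_disjoint (by
      rw [Finset.disjoint_left]; grind), ← hS.card_eq,
      ← Finset.card_inter_add_card_sdiff S N] at hcard
    have hunion : S ∩ N ∪ ((X ∩ S).biUnion fun w => G.neighborFinset w) ⊆ N :=
      Finset.union_subset Finset.inter_subset_right
        (Finset.biUnion_subset_biUnion_of_subset_left _ Finset.inter_subset_left)
    have hdisj : Disjoint (S ∩ N) ((X ∩ S).biUnion fun w => G.neighborFinset w) := by
      rw [Finset.disjoint_left]
      simp only [Finset.mem_biUnion, mem_neighborFinset]
      grind
    have := Finset.card_le_card hunion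
    rw [Finset.card_union_of_disjoint hdisj] at this
    have := Finset.card_inter_add_card_sdiff X S
    lia

/-- Hajnal's degree bound for graphs without isolated vertices in which every edge is critical for
the independence number. -/
lemma degree_add_two_mul_indepNum_le (hiso : ∀ v, ∃ u, G.Adj v u)
    (hcrit : ∀ u v, G.Adj u v → ∃ J : Finset V, u ∉ J ∧ v ∉ J ∧
      G.IsNIndepSet G.indepNum (insert u J) ∧ G.IsNIndepSet G.indepNum (insert v J)) (v : V) :
    G.degree v + 2 * G.indepNum ≤ Fintype.card V + 1 := by
  classical
  let F : Finset (Finset V) := {S | G.IsNIndepSet G.indepNum S ∧ v ∈ S}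
  have hmemF : ∀ S, S ∈ F ↔ G.IsNIndepSet G.indepNum S ∧ v ∈ S := by simp [F]
  have hF : F.Nonempty := by
    obtain ⟨u, hvu⟩ := hiso v
    obtain ⟨J, -, -, hJ, -⟩ := hcrit v u hvu
    exact ⟨_, (hmemF _).2 ⟨hJ, Finset.mem_insert_self v J⟩⟩
  have hajnal := two_mul_indepNum_le_card_union_add_card_inter F hF fun S hS => ((hmemF S).1 hS).1
  set U := F.biUnion id
  set I : Finset V := {w | ∀ S ∈ F, w ∈ S} with hI
  have hmemI : ∀ w, w ∈ I ↔ ∀ S ∈ F, w ∈ S := by simp [hI]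
  have hvI : v ∈ I := (hmemI v).2 fun S hS => ((hmemF S).1 hS).2
  have hUI : ∀ u ∈ U, ∀ w ∈ I, ¬ G.Adj w u := by
    intro u hu w hw
    obtain ⟨S, hS, huS⟩ := Finset.mem_biUnion.1 hu
    exact isIndepSet_coe_iff.1 ((hmemF S).1 hS).1.isIndepSet w ((hmemI w).1 hw S hS) u huS
  have hIU : I ⊆ U := fun w hw => by
    obtain ⟨S, hS⟩ := hF
    exact Finset.mem_biUnion.2 ⟨S, hS, (hmemI w).1 hw S hS⟩
  have hX : (I.erase v).card ≤ ((I.erase v).biUnion fun w => G.neighborFinset w).card := by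
    refine card_le_card_biUnion_neighborFinset (fun w => ?_) _ ?_
    · obtain ⟨z, hwz⟩ := hiso w
      obtain ⟨J, hwJ, -, -, hJ⟩ := hcrit w z hwz
      exact ⟨_, hJ, by simp [hwJ, hwz.ne]⟩
    · rw [isIndepSet_coe_iff]
      grind
  set N := (I.erase v).biUnion fun w => G.neighborFinset w with hN
  have hmemN : ∀ u, u ∈ N ↔ ∃ w ∈ I.erase v, G.Adj w u := by simp [hN]
  have hdisjN : Disjoint (G.neighborFinset v) N := by
    rw [Finset.disjoint_left]
    intro u hu huN
    rw [mem_neighborFinset] at hu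
    obtain ⟨w, hw, hwu⟩ := (hmemN u).1 huN
    obtain ⟨J, -, -, hJv, hJu⟩ := hcrit v u hu
    have hwJ := (hmemI w).1 (Finset.mem_of_mem_erase hw) _
      ((hmemF _).2 ⟨hJv, Finset.mem_insert_self v J⟩)
    have := isIndepSet_coe_iff.1 hJu.isIndepSet w (by grind) u (Finset.mem_insert_self u J)
    exact this hwu
  have hdisjU : Disjoint U (G.neighborFinset v ∪ N) := by
    rw [Finset.disjoint_left]
    intro u hu
    rw [Finset.mem_union, mem_neighborFinset, hmemN]
    grind
  have htotal := Finset.card_le_univ (U ∪ (G.neighborFinset v ∪ N))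
  rw [Finset.card_union_of_disjoint hdisjU, Finset.card_union_of_disjoint hdisjN,
    card_neighborFinset_eq_degree] at htotal
  have := Finset.card_erase_add_one hvI
  lia

end IndepSet

section Transversal

variable {V : Type*} [Fintype V] {G : SimpleGraph V}

lemma tau_le_card {S : Finset V} (hS : IsTransversal G (S : Set V)) : tau G ≤ S.card :=
  Nat.sInf_le ⟨S, hS, rfl⟩

lemma exists_isTransversal_card_eq_tau (G : SimpleGraph V) :
    ∃ S : Finset V, IsTransversal G (S : Set V) ∧ S.card = tau G :=
  Nat.sInf_mem (s := {n | ∃ S : Finset V, IsTransversal G ↑S ∧ S.card = n})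
    ⟨_, Finset.univ, fun u _ _ => Or.inl (by simp), rfl⟩

variable [DecidableEq V]

lemma isIndepSet_compl_iff_isTransversal {S : Finset V} :
    G.IsIndepSet ((Sᶜ : Finset V) : Set V) ↔ IsTransversal G (S : Set V) := by
  rw [isIndepSet_coe_iff]
  simp only [IsTransversal, Finset.mem_compl, Finset.mem_coe]
  grind

lemma tau_add_indepNum (G : SimpleGraph V) : tau G + G.indepNum = Fintype.card V := by
  apply le_antisymm
  · obtain ⟨S, hS⟩ := G.exists_isNIndepSet_indepNum
    have hle : tau G ≤ Sᶜ.card :=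
      tau_le_card (isIndepSet_compl_iff_isTransversal.1 (by simpa using hS.isIndepSet))
    have := Finset.card_add_card_compl S
    have := hS.card_eq
    lia
  · obtain ⟨T, hT, hcard⟩ := exists_isTransversal_card_eq_tau G
    have := (isIndepSet_compl_iff_isTransversal.2 hT).card_le_indepNum
    have := Finset.card_add_card_compl T
    lia

lemma TauCritical.exists_isNIndepSet_insert (hcrit : TauCritical G) {u v : V} (huv : G.Adj u v) :
    ∃ J : Finset V, u ∉ J ∧ v ∉ J ∧
      G.IsNIndepSet G.indepNum (insert u J) ∧ G.IsNIndepSet G.indepNum (insert v J) := by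
  obtain ⟨C, hC, hcard⟩ := exists_isTransversal_card_eq_tau (G.deleteEdges {s(u, v)})
  rw [hcrit.2 _ huv] at hcard
  have hcover : ∀ a b, G.Adj a b → a ∈ C ∨ b ∈ C ∨ a = u ∧ b = v ∨ a = v ∧ b = u := by
    intro a b hab
    by_cases h : s(a, b) = s(u, v)
    · exact Or.inr (Or.inr (Sym2.eq_iff.1 h))
    · exact (hC (G.deleteEdges_adj.2 ⟨hab, h⟩)).imp_right Or.inl
  have hpos : 0 < tau G := by
    obtain ⟨T, hT, hTcard⟩ := exists_isTransversal_card_eq_tau G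
    rw [← hTcard, Finset.card_pos]
    exact (hT huv).elim (fun h => ⟨u, h⟩) fun h => ⟨v, h⟩
  have hnot : ¬ (u ∈ C ∨ v ∈ C) := fun h => by
    have : IsTransversal G (C : Set V) := fun a b hab => by
      have := hcover a b hab
      simp only [Finset.mem_coe]
      grind
    have := tau_le_card this
    lia
  push Not at hnot
  have hmax : ∀ x ∉ C, (x = u ∨ x = v) → G.IsNIndepSet G.indepNum (insert x C)ᶜ := by
    intro x hx hxuv
    refine ⟨isIndepSet_compl_iff_isTransversal.2 fun a b hab => ?_, ?_⟩
    · have := hcover a b hab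
      simp only [Finset.mem_coe]
      grind
    · have := Finset.card_add_card_compl (insert x C)
      rw [Finset.card_insert_of_notMem hx] at this
      have := tau_add_indepNum G
      lia
  have hne := huv.ne
  refine ⟨(insert u (insert v C))ᶜ, by simp, by simp, ?_, ?_⟩
  · convert hmax v hnot.2 (Or.inr rfl) using 1
    grind [Finset.mem_compl]
  · convert hmax u hnot.1 (Or.inl rfl) using 1
    grind [Finset.mem_compl]

end Transversal

theorem order_plus_size_le {V : Type*} [Fintype V] [DecidableEq V]
    (G : SimpleGraph V) [DecidableRel G.Adj] (t : ℕ)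
    (hcrit : TauCritical G) (ht : tau G = t) :
    Fintype.card V + G.edgeFinset.card ≤ (t + 2).choose 2 := by
  have hsum : ∑ v, (G.degree v + 2 * G.indepNum) ≤ ∑ _v : V, (Fintype.card V + 1) :=
    Finset.sum_le_sum fun v _ =>
      degree_add_two_mul_indepNum_le hcrit.1 (fun _ _ => hcrit.exists_isNIndepSet_insert) v
  rw [Finset.sum_add_distrib, sum_degrees_eq_twice_card_edges] at hsum
  simp only [Finset.sum_const, Finset.card_univ, smul_eq_mul] at hsum
  have hn := tau_add_indepNum G
  rw [ht] at hn
  have hchoose : (t + 2).choose 2 * 2 = (t + 2) * (t + 1) := by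
    simpa using (Nat.add_one_mul_choose_eq (t + 1) 1).symm
  rw [← hn] at hsum ⊢
  -- this is `0 ≤ (α - 1) * (α - 2)`
  have hα : 3 * G.indepNum ≤ G.indepNum * G.indepNum + 2 := by
    rcases le_or_gt G.indepNum 2 with h | h
    · interval_cases G.indepNum <;> simp
    · nlinarith
  nlinarith
end

section
/- Let H be a finite simple graph on at least 4 vertices that is regular of degree 2, and suppose that for every pair of distinct non-adjacent vertices u, v of H, the graph obtained from H by adding the edge uv contains a triangle through the edge uv. Then H is isomorphic to the cycle C_4 or to the cycle C_5. -/
open SimpleGraph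

/-- In a 2-regular graph, a vertex `v` with a neighbor `a` has exactly one other neighbor. -/
lemma SimpleGraph.IsRegularOfDegree.exists_other_neighbor {V : Type*} [Fintype V]
    [DecidableEq V] {H : SimpleGraph V} [DecidableRel H.Adj] (hreg : H.IsRegularOfDegree 2)
    {v a : V} (hva : H.Adj v a) :
    ∃ b, b ≠ a ∧ ∀ x, H.Adj v x ↔ x = a ∨ x = b := by
  obtain ⟨p, q, hpq, hN⟩ := Finset.card_eq_two.mp (hreg v)
  have hadj : ∀ x, H.Adj v x ↔ x = p ∨ x = q := fun x => by
    rw [← mem_neighborFinset, hN]; simp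
  rcases (hadj a).mp hva with rfl | rfl
  · exact ⟨q, hpq.symm, hadj⟩
  · exact ⟨p, hpq, fun x => (hadj x).trans or_comm⟩

/-- A bijection from `Fin n` that matches adjacency exhibits a graph as a cycle. -/
lemma SimpleGraph.nonempty_iso_cycleGraph {V : Type*} {H : SimpleGraph V} {n : ℕ}
    (f : Fin n → V) (hf : Function.Bijective f)
    (hadj : ∀ i j, H.Adj (f i) (f j) ↔ (cycleGraph n).Adj i j) :
    Nonempty (H ≃g cycleGraph n) :=
  ⟨(RelIso.mk (Equiv.ofBijective f hf) (hadj _ _) : cycleGraph n ≃g H).symm⟩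

theorem two_regular_triangle_saturated {V : Type*} [Fintype V] [DecidableEq V]
    (H : SimpleGraph V) [DecidableRel H.Adj]
    (hcard : 4 ≤ Fintype.card V) (hreg : H.IsRegularOfDegree 2)
    (htri : ∀ u v : V, u ≠ v → ¬H.Adj u v →
      ∃ w : V, (H ⊔ fromEdgeSet {s(u, v)}).Adj u w ∧ (H ⊔ fromEdgeSet {s(u, v)}).Adj v w) :
    Nonempty (H ≃g cycleGraph 4) ∨ Nonempty (H ≃g cycleGraph 5) := by
  have hcommon : ∀ u v : V, u ≠ v → ¬H.Adj u v → ∃ w, H.Adj u w ∧ H.Adj v w := by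
    intro u v huv hnadj
    obtain ⟨w, hu, hv⟩ := htri u v huv hnadj
    have hwu := hu.ne
    have hwv := hv.ne
    simp only [sup_adj, fromEdgeSet_adj, Set.mem_singleton_iff, Sym2.eq_iff] at hu hv
    exact ⟨w, by grind⟩
  clear htri
  obtain ⟨v⟩ : Nonempty V := Fintype.card_pos_iff.mp (by omega)
  obtain ⟨a, ha⟩ : ∃ a, H.Adj v a := (H.degree_pos_iff_exists_adj v).mp (by rw [hreg v]; simp)
  obtain ⟨b, hba, hv⟩ := hreg.exists_other_neighbor ha
  have hb : H.Adj v b := (hv b).mpr (Or.inr rfl)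
  have hva := ha.ne
  have hvb := hb.ne
  obtain ⟨c, hcv, hNa⟩ := hreg.exists_other_neighbor ha.symm
  obtain ⟨d, hdv, hNb⟩ := hreg.exists_other_neighbor hb.symm
  have hcover : ∀ x, x = v ∨ x = a ∨ x = b ∨ x = c ∨ x = d := by
    intro x
    by_cases hxv : v = x
    · exact Or.inl hxv.symm
    by_cases hadj : H.Adj v x
    · grind
    obtain ⟨w, hvw, hxw⟩ := hcommon v x hxv hadj
    have := hxw.symm
    grind
  have hab : ¬H.Adj a b := by
    intro hab
    have hbc : b = c := by grind
    have had : a = d := by have := hab.symm; grind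
    have hsub : (Finset.univ : Finset V) ⊆ {v, a, b} := fun x _ => by
      have := hcover x
      simp only [Finset.mem_insert, Finset.mem_singleton]
      grind
    have := (Finset.card_le_card hsub).trans Finset.card_le_three
    rw [Finset.card_univ] at this
    omega
  have hac : H.Adj a c := (hNa c).mpr (Or.inr rfl)
  have hbd : H.Adj b d := (hNb d).mpr (Or.inr rfl)
  have hca := hac.ne
  have hdb := hbd.ne
  have hcb : c ≠ b := by grind
  have hda : d ≠ a := by rintro rfl; exact hab hbd.symm
  obtain ⟨e, hea, hNc⟩ := hreg.exists_other_neighbor hac.symm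
  by_cases hcd : c = d
  · subst hcd
    left
    have hcb' := hbd.symm
    refine nonempty_iso_cycleGraph ![v, a, c, b] ⟨?_, ?_⟩ ?_
    · intro i j
      fin_cases i <;> fin_cases j <;> simp <;> grind
    · intro x
      rcases hcover x with rfl | rfl | rfl | rfl | rfl
      exacts [⟨0, rfl⟩, ⟨1, rfl⟩, ⟨3, rfl⟩, ⟨2, rfl⟩, ⟨2, rfl⟩]
    · intro i j
      fin_cases i <;> fin_cases j <;> simp [cycleGraph_adj, hv, hNa, hNb, hNc] <;> grind
  · right
    have hce : H.Adj c e := (hNc e).mpr (Or.inr rfl)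
    have hec := hce.symm
    have hed : e = d := by
      rcases hcover e with rfl | rfl | rfl | rfl | rfl <;> grind [SimpleGraph.irrefl]
    subst hed
    obtain ⟨g, hgc, hNd⟩ := hreg.exists_other_neighbor hec
    have hgb : g = b := by
      have := (hNd b).mp hbd.symm
      grind
    subst hgb
    refine nonempty_iso_cycleGraph ![v, a, c, e, g] ⟨?_, ?_⟩ ?_
    · intro i j
      fin_cases i <;> fin_cases j <;> simp <;> grind
    · intro x
      rcases hcover x with rfl | rfl | rfl | rfl | rfl
      exacts [⟨0, rfl⟩, ⟨1, rfl⟩, ⟨4, rfl⟩, ⟨2, rfl⟩, ⟨3, rfl⟩]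
    · intro i j
      fin_cases i <;> fin_cases j <;> simp [cycleGraph_adj, hv, hNa, hNb, hNc, hNd] <;> grind
end
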